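/- Suppose f : ℝ^d → ℝ is real-valued with f̂ ∈ L¹(ℝ^d), ‖f‖_{B^{1,log}} < ∞ and ‖f‖_{B¹} > 0. For any m ∈ ℕ and any compact set Ω ⊂ [0,1]^d, there exist ReLU networks F₁,…,F_m : ℝ^d → ℝ, each of width 3, with depths L₁,…,L_m, such that ‖f − (1/m)∑_{i=1}^m F_i‖²_{H¹(Ω)} ≤ (11π⁴/m)·|Ω|·‖f‖²_{B¹} and ∑_{i=1}^m L_i ≤ 5m·‖f‖_{B^{1,log}}/‖f‖_{B¹}. -/

import Mathlib

open MeasureTheory Real Filter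

noncomputable section

/-- The ℓ¹ norm on `ℝ^d`. -/
def l1 {d : ℕ} (ξ : Fin d → ℝ) : ℝ := ∑ i, |ξ i|

/-- The Fourier transform `f̂(ξ) = ∫ f(x) e^{-2πi ξ·x} dx`. -/
def fhat {d : ℕ} (f : (Fin d → ℝ) → ℂ) (ξ : Fin d → ℝ) : ℂ :=
  ∫ x : Fin d → ℝ,
    Complex.exp (-(2 * (Real.pi : ℂ) * Complex.I * ((∑ i, ξ i * x i : ℝ) : ℂ))) * f x

/-- Fourier transform of a real-valued function. -/
def fhatR {d : ℕ} (f : (Fin d → ℝ) → ℝ) : (Fin d → ℝ) → ℂ :=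
  fhat (fun x => (f x : ℂ))

/-- log-Barron norm `∫ log₂(2+‖ξ‖₁)|g(ξ)| dξ` of a frequency-side function `g`. -/
def logBarron {d : ℕ} (g : (Fin d → ℝ) → ℂ) : ℝ :=
  ∫ ξ : Fin d → ℝ, Real.logb 2 (2 + l1 ξ) * ‖g ξ‖

/-- Barron norm of order 0 : `∫ (1 + ‖ξ‖₁⁰)|g(ξ)| dξ = 2∫|g(ξ)|dξ`. -/
def B0 {d : ℕ} (g : (Fin d → ℝ) → ℂ) : ℝ := 2 * ∫ ξ : Fin d → ℝ, ‖g ξ‖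

/-- Barron norm of order 1 : `∫ (1 + ‖ξ‖₁)|g(ξ)| dξ`. -/
def B1 {d : ℕ} (g : (Fin d → ℝ) → ℂ) : ℝ := ∫ ξ : Fin d → ℝ, (1 + l1 ξ) * ‖g ξ‖

/-- first-order log-Barron norm `∫ (1+‖ξ‖₁) log₂(2+‖ξ‖₁)|g(ξ)| dξ`. -/
def B1log {d : ℕ} (g : (Fin d → ℝ) → ℂ) : ℝ :=
  ∫ ξ : Fin d → ℝ, (1 + l1 ξ) * Real.logb 2 (2 + l1 ξ) * ‖g ξ‖

/-- One hidden ReLU layer `z ↦ ReLU(Wz+b)`. -/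
def reluLayer {N : ℕ} (W : Matrix (Fin N) (Fin N) ℝ) (b : Fin N → ℝ) (z : Fin N → ℝ) :
    Fin N → ℝ :=
  fun i => max 0 (W.mulVec z i + b i)

/-- Iterate `k` hidden layers. -/
def hiddenIter {N : ℕ} (W : ℕ → Matrix (Fin N) (Fin N) ℝ) (b : ℕ → Fin N → ℝ) :
    ℕ → (Fin N → ℝ) → (Fin N → ℝ)
  | 0, z => z
  | k + 1, z => reluLayer (W k) (b k) (hiddenIter W b k z)

/-- `F : ℝ^d → ℝ` is a ReLU network of width `N` and depth `L`:
`F(x) = W_L z_{L-1}`, `z₀ = x`, `z_l = ReLU(W_l z_{l-1} + b_l)` for `1 ≤ l ≤ L-1`. -/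
def IsReLUNet (d N L : ℕ) (F : (Fin d → ℝ) → ℝ) : Prop :=
  ∃ (W₁ : Matrix (Fin N) (Fin d) ℝ) (b₁ : Fin N → ℝ)
    (W : ℕ → Matrix (Fin N) (Fin N) ℝ) (b : ℕ → Fin N → ℝ) (Wout : Fin N → ℝ),
    ∀ x, F x = ∑ i, Wout i *
      hiddenIter W b (L - 2) (fun j => max 0 (W₁.mulVec x j + b₁ j)) i

/-- `v` is the `j`-th weak partial derivative of `u` on `Ω`. -/
def HasWeakPartial {d : ℕ} (Ω : Set (Fin d → ℝ)) (u : (Fin d → ℝ) → ℝ) (j : Fin d)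
    (v : (Fin d → ℝ) → ℝ) : Prop :=
  ∀ φ : (Fin d → ℝ) → ℝ, ContDiff ℝ (⊤ : ℕ∞) φ → HasCompactSupport φ → tsupport φ ⊆ interior Ω →
    ∫ x in Ω, u x * fderiv ℝ φ x (Pi.single j 1) = - ∫ x in Ω, v x * φ x

/-- Euclidean diameter of a set in `ℝ^d`. -/
def eucDiam {d : ℕ} (Ω : Set (Fin d → ℝ)) : ℝ :=
  sSup {r : ℝ | ∃ x ∈ Ω, ∃ y ∈ Ω, r = Real.sqrt (∑ i, (x i - y i) ^ 2)}



open scoped FourierTransform SchwartzMap in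
theorem ae_inv {d : ℕ} (f : EuclideanSpace ℝ (Fin d) → ℂ) (hf : Integrable f)
    (hF : Integrable (𝓕 f)) : f =ᵐ[volume] 𝓕⁻ (𝓕 f) := by
  have hinvcont : Continuous (𝓕⁻ (𝓕 f)) := by
    have := VectorFourier.fourierIntegral_continuous (μ := volume) (L := -(innerₗ (EuclideanSpace ℝ (Fin d))))
      Real.continuous_fourierChar (continuous_inner.neg) hF
    exact this
  apply ae_eq_of_integral_contDiff_smul_eq hf.locallyIntegrable hinvcont.locallyIntegrable
  intro g hg hgc
  have hgc' : HasCompactSupport (fun x => (g x : ℂ)) := hgc.comp_left (g := fun t : ℝ => (t : ℂ)) (by simp)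
  have hg' : ContDiff ℝ (⊤ : ℕ∞) (fun x => (g x : ℂ)) := Complex.ofRealCLM.contDiff.comp hg
  let φ : 𝓢(EuclideanSpace ℝ (Fin d), ℂ) := hgc'.toSchwartzMap hg'
  have hφ : ∀ x, φ x = (g x : ℂ) := fun x => rfl
  let ψ : 𝓢(EuclideanSpace ℝ (Fin d), ℂ) := 𝓕⁻ φ
  have hψ : 𝓕 ψ = φ := by simp [ψ]
  have h1 := VectorFourier.integral_fourierIntegral_smul_eq_flip (μ := volume) (ν := volume)
    (L := (innerₗ (EuclideanSpace ℝ (Fin d)))) (f := f) (g := ψ)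
      Real.continuous_fourierChar (by simpa using continuous_inner) hf ψ.integrable
  have h2 := VectorFourier.integral_fourierIntegral_smul_eq_flip (μ := volume) (ν := volume)
    (L := -(innerₗ (EuclideanSpace ℝ (Fin d)))) (f := 𝓕 f) (g := φ)
      Real.continuous_fourierChar (continuous_inner.neg) hF φ.integrable
  have e1 : ∀ x, VectorFourier.fourierIntegral 𝐞 volume (innerₗ (EuclideanSpace ℝ (Fin d))).flip (ψ : EuclideanSpace ℝ (Fin d) → ℂ) x = φ x := by
    intro x
    rw [flip_innerₗ]
    have : (𝓕 (ψ : EuclideanSpace ℝ (Fin d) → ℂ)) x = φ x := by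
      rw [← SchwartzMap.fourier_coe, hψ]
    exact this
  have e2 : ∀ x, VectorFourier.fourierIntegral 𝐞 volume (-(innerₗ (EuclideanSpace ℝ (Fin d)))).flip (φ : EuclideanSpace ℝ (Fin d) → ℂ) x = ψ x := by
    intro x
    have : (𝓕⁻ (φ : EuclideanSpace ℝ (Fin d) → ℂ)) x = ψ x := by
      rw [← SchwartzMap.fourierInv_coe]
    rw [← this]
    have : (-(innerₗ (EuclideanSpace ℝ (Fin d)))).flip = -(innerₗ (EuclideanSpace ℝ (Fin d))) := by
      ext; simp [real_inner_comm]
    rw [this]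
    rfl
  simp_rw [e1] at h1
  simp_rw [e2] at h2
  calc ∫ x, g x • f x = ∫ x, f x • φ x := by
        congr 1; ext x; simp [hφ, mul_comm]
    _ = ∫ x, (𝓕 f) x • ψ x := h1.symm
    _ = ∫ x, (𝓕⁻ (𝓕 f)) x • φ x := h2.symm
    _ = _ := by congr 1; ext x; simp [hφ, mul_comm]

open scoped FourierTransform in
theorem fhat_inv {d : ℕ} (f : (Fin d → ℝ) → ℝ) (hf : Integrable f) (hF : Integrable (fhatR f)) :
    ∀ᵐ x, f x = (∫ ξ, fhatR f ξ * Complex.exp (2 * π * Complex.I * ((∑ i, ξ i * x i : ℝ) : ℂ))).re := by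
  have hmp := PiLp.volume_preserving_ofLp (Fin d)
  have hmp' := PiLp.volume_preserving_toLp (Fin d)
  have hemb : MeasurableEmbedding (@WithLp.ofLp 2 (Fin d → ℝ)) := (MeasurableEquiv.toLp 2 (Fin d → ℝ)).symm.measurableEmbedding
  let f' : EuclideanSpace ℝ (Fin d) → ℂ := fun x => (f (x.ofLp) : ℂ)
  have hf' : Integrable f' := by
    have : Integrable (fun x => (f x : ℂ)) := hf.ofReal
    exact (hmp.integrable_comp_emb hemb).2 this
  have hFf : ∀ w : EuclideanSpace ℝ (Fin d), 𝓕 f' w = fhatR f w.ofLp := by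
    intro w
    rw [Real.fourier_eq, fhatR, fhat, ← hmp.integral_comp hemb]
    congr 1; ext v
    rw [Circle.smul_def, Real.fourierChar_apply]
    simp only [f', smul_eq_mul]
    congr 2
    simp [PiLp.inner_apply]
    ring
  have hFi : Integrable (𝓕 f') := by
    have : 𝓕 f' = fun w : EuclideanSpace ℝ (Fin d) => fhatR f w.ofLp := funext hFf
    rw [this]
    exact (hmp.integrable_comp_emb hemb).2 hF
  have h := ae_inv f' hf' hFi
  have h2 := hmp'.quasiMeasurePreserving.ae h
  filter_upwards [h2] with x hx
  have hx' : (f x : ℂ) = 𝓕⁻ (𝓕 f') (WithLp.toLp 2 x) := hx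
  rw [← Complex.ofReal_re (f x), hx', Real.fourierInv_eq, ← hmp.integral_comp hemb]
  congr 2; ext v
  rw [Circle.smul_def, Real.fourierChar_apply, hFf]
  simp only [smul_eq_mul]
  rw [mul_comm]
  congr 2
  simp [PiLp.inner_apply]
  simp only [mul_comm]
  ring_nf

def tri (t : ℝ) : ℝ := |t - round t|

theorem tri_eq (t : ℝ) : tri t = ‖(t : UnitAddCircle)‖ := UnitAddCircle.norm_eq.symm

theorem tri_lip : LipschitzWith 1 tri := by
  apply LipschitzWith.of_dist_le_mul
  intro x y
  rw [Real.dist_eq, Real.dist_eq, tri_eq, tri_eq]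
  have h := abs_norm_sub_norm_le (x : UnitAddCircle) (y : UnitAddCircle)
  refine h.trans ?_
  rw [← AddCircle.coe_sub, UnitAddCircle.norm_eq]
  simpa only [Int.cast_zero, sub_zero, NNReal.coe_one, one_mul] using round_le (x - y) 0

theorem tri_nonneg (t : ℝ) : 0 ≤ tri t := abs_nonneg _

theorem tri_le (t : ℝ) : tri t ≤ 1 / 2 := abs_sub_round t

theorem tri_add_int (t : ℝ) (n : ℤ) : tri (t + n) = tri t := by
  simp [tri]

theorem tri_neg (t : ℝ) : tri (-t) = tri t := by
  rw [tri_eq, tri_eq, AddCircle.coe_neg, norm_neg]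

theorem tri_two_tri (t : ℝ) : tri (2 * tri t) = tri (2 * t) := by
  have h : tri (2 * (t - round t)) = tri (2 * t) := by
    have := tri_add_int (2 * t) (-(2 * round t))
    push_cast at this
    rw [← this]; ring_nf
  unfold tri at h ⊢
  rcases abs_choice (t - round t) with h1 | h1
  · rw [h1]; exact h
  · rw [h1, ← h]
    have := tri_neg (2 * (t - round t))
    unfold tri at this
    rw [← this]; ring_nf

theorem tri_unit (y : ℝ) (h0 : 0 ≤ y) (h1 : y ≤ 1) :
    2 * max 0 y - 4 * max 0 (y - 1 / 2) = 2 * tri y := by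
  rcases h1.eq_or_lt with rfl | h1
  · have : tri 1 = 0 := by simp [tri]
    rw [this]; norm_num
  · unfold tri
    rw [abs_sub_round_eq_min, Int.fract_eq_self.2 ⟨h0, h1⟩, max_eq_right h0]
    rcases le_total y (1/2) with h | h
    · rw [max_eq_left (by linarith), min_eq_left (by linarith)]; ring
    · rw [max_eq_right (by linarith), min_eq_right (by linarith)]; ring

theorem cos_tri (t : ℝ) : Real.cos (2 * π * tri t) = Real.cos (2 * π * t) := by
  have h : Real.cos (2 * π * (t - round t)) = Real.cos (2 * π * t) := by
    rw [← Real.cos_sub_int_mul_two_pi (2 * π * t) (round t)]; ring_nf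
  unfold tri
  rcases abs_choice (t - round t) with h1 | h1
  · rw [h1, h]
  · rw [h1, ← h, ← Real.cos_neg]; ring_nf

theorem int_relu (u : ℝ) (h0 : 0 ≤ u) (h1 : u ≤ 1 / 2) :
    ∫ s in (0 : ℝ)..(1 / 2), Real.cos (2 * π * s) * max 0 (u - s) =
      (1 - Real.cos (2 * π * u)) / (4 * π ^ 2) := by
  have hc : Continuous fun s : ℝ => Real.cos (2 * π * s) * max 0 (u - s) := by fun_prop
  rw [← intervalIntegral.integral_add_adjacent_intervals (b := u) (hc.intervalIntegrable _ _)
    (hc.intervalIntegrable _ _)]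
  have e2 : ∫ s in u..(1 / 2), Real.cos (2 * π * s) * max 0 (u - s) = 0 := by
    rw [intervalIntegral.integral_congr (g := fun _ => 0)]
    · simp
    · intro s hs
      rw [Set.uIcc_of_le h1] at hs
      simp only
      rw [max_eq_left (by linarith [hs.1])]; simp
  have e1 : ∫ s in (0 : ℝ)..u, Real.cos (2 * π * s) * max 0 (u - s) =
      ∫ s in (0 : ℝ)..u, Real.cos (2 * π * s) * (u - s) := by
    apply intervalIntegral.integral_congr
    intro s hs
    rw [Set.uIcc_of_le h0] at hs
    simp only
    rw [max_eq_right (by linarith [hs.2])]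
  have hpi := Real.pi_pos
  rw [e2, e1, intervalIntegral.integral_eq_sub_of_hasDerivAt
    (f := fun s => (u - s) * (Real.sin (2 * π * s) / (2 * π)) - Real.cos (2 * π * s) / (4 * π ^ 2))]
  · simp; field_simp; ring
  · intro s _
    have h2 : HasDerivAt (fun s : ℝ => 2 * π * s) (2 * π) s := by
      simpa using (hasDerivAt_id s).const_mul (2 * π)
    have hs := (((hasDerivAt_id s).const_sub u).mul (h2.sin.div_const (2 * π))).sub
      (h2.cos.div_const (4 * π ^ 2))
    refine hs.congr_deriv ?_
    simp; field_simp; ring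
  · apply Continuous.intervalIntegrable; fun_prop

theorem int_cos_sq : ∫ s in (0 : ℝ)..(1 / 2), Real.cos (2 * π * s) ^ 2 = 1 / 4 := by
  have hpi := Real.pi_pos
  rw [intervalIntegral.integral_eq_sub_of_hasDerivAt
    (f := fun s => s / 2 + Real.sin (2 * (2 * π * s)) / (8 * π))]
  · have : 2 * (2 * π * (1 / 2)) = 2 * π := by ring
    rw [this]; simp; norm_num
  · intro s _
    have h2 : HasDerivAt (fun s : ℝ => 2 * (2 * π * s)) (4 * π) s := by
      have := (hasDerivAt_id s).const_mul (4 * π)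
      refine (this.congr_deriv (by simp)).congr_of_eventuallyEq (Eventually.of_forall fun x => ?_)
      simp; ring
    have hs := ((hasDerivAt_id s).div_const 2).add (h2.sin.div_const (8 * π))
    refine hs.congr_deriv ?_
    rw [Real.cos_two_mul]; field_simp; ring
  · apply Continuous.intervalIntegrable; fun_prop

theorem l1_nonneg {d : ℕ} (ξ : Fin d → ℝ) : 0 ≤ l1 ξ := Finset.sum_nonneg fun _ _ => abs_nonneg _

theorem net_exists {d : ℕ} (ξ : Fin d → ℝ) (θ s c w : ℝ) :
    ∃ (L : ℕ) (F : (Fin d → ℝ) → ℝ), IsReLUNet d 3 L F ∧ (L : ℝ) ≤ 4 * Real.logb 2 (2 + l1 ξ) ∧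
      ∀ x ∈ Set.Icc (0 : Fin d → ℝ) 1,
        F x = c * (1 - w * max 0 (tri (∑ i, ξ i * x i + θ) - s)) := by
  have hr := l1_nonneg ξ
  obtain ⟨K, hK1, hK2⟩ : ∃ K : ℕ, 1 + l1 ξ ≤ 2 ^ K ∧ (K : ℝ) ≤ 1 + Real.logb 2 (1 + l1 ξ) := by
    refine ⟨⌈Real.logb 2 (1 + l1 ξ)⌉₊, ?_, ?_⟩
    · have := Nat.le_ceil (Real.logb 2 (1 + l1 ξ))
      rwa [Real.logb_le_iff_le_rpow one_lt_two (by linarith), Real.rpow_natCast] at this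
    · have h0 : 0 ≤ Real.logb 2 (1 + l1 ξ) := Real.logb_nonneg one_lt_two (by linarith)
      have := Nat.ceil_lt_add_one h0
      linarith
  set a : ℝ := ∑ i, min (ξ i) 0 + θ with ha
  let n : ℤ := -⌊a⌋
  have hP : (0 : ℝ) < 2 ^ K := by positivity
  let W₁ : Matrix (Fin 3) (Fin d) ℝ := fun j => if j = 2 then 0 else fun i => ξ i / 2 ^ K
  let b₁ : Fin 3 → ℝ := ![(θ + n) / 2 ^ K, (θ + n) / 2 ^ K - 1 / 2, 0]
  let W : ℕ → Matrix (Fin 3) (Fin 3) ℝ := fun k =>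
    if k = K then ![![1, -2, 0], 0, 0] else ![![2, -4, 0], ![2, -4, 0], 0]
  let b : ℕ → Fin 3 → ℝ := fun k => if k = K then ![-s, 1, 0] else ![0, -1 / 2, 0]
  let Wout : Fin 3 → ℝ := ![-(c * w), c, 0]
  refine ⟨K + 3, fun x => ∑ i, Wout i *
      hiddenIter W b (K + 3 - 2) (fun j => max 0 (W₁.mulVec x j + b₁ j)) i,
    ⟨W₁, b₁, W, b, Wout, fun x => rfl⟩, ?_, ?_⟩
  · push_cast
    have h4 : 4 + Real.logb 2 (1 + l1 ξ) ≤ 4 * Real.logb 2 (2 + l1 ξ) := by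
      have e1 : 4 + Real.logb 2 (1 + l1 ξ) = Real.logb 2 (16 * (1 + l1 ξ)) := by
        rw [Real.logb_mul (by norm_num) (by linarith)]
        congr 1
        rw [show (16 : ℝ) = 2 ^ (4 : ℕ) by norm_num, Real.logb_pow]; norm_num
      have e2 : 4 * Real.logb 2 (2 + l1 ξ) = Real.logb 2 ((2 + l1 ξ) ^ 4) := by
        rw [Real.logb_pow]; norm_num
      rw [e1, e2]
      apply Real.logb_le_logb_of_le (by norm_num) (by linarith)
      have := pow_nonneg hr 2
      have := pow_nonneg hr 3
      have := pow_nonneg hr 4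
      nlinarith
    linarith
  · intro x hx
    set t : ℝ := ∑ i, ξ i * x i + θ with ht
    set y : ℝ := (t + n) / 2 ^ K with hy
    have hta : a ≤ t := by
      simp only [ha, ht]
      gcongr with i
      have h0 := hx.1 i
      have h1 := hx.2 i
      simp only [Pi.zero_apply, Pi.one_apply] at h0 h1
      rcases le_total (ξ i) 0 with h | h
      · rw [min_eq_left h]; nlinarith
      · rw [min_eq_right h]; positivity
    have hta' : t ≤ a + l1 ξ := by
      have : ∑ i, ξ i * x i ≤ ∑ i, min (ξ i) 0 + l1 ξ := by
        rw [l1, ← Finset.sum_add_distrib]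
        gcongr with i
        have h0 := hx.1 i
        have h1 := hx.2 i
        simp only [Pi.zero_apply, Pi.one_apply] at h0 h1
        rcases le_total (ξ i) 0 with h | h
        · rw [min_eq_left h, abs_of_nonpos h]; nlinarith
        · rw [min_eq_right h, abs_of_nonneg h]; nlinarith
      simp only [ha, ht]; linarith
    have hn1 : 0 ≤ a + n := by
      have := Int.floor_le a
      simp only [n]; push_cast; linarith
    have hn2 : a + n ≤ 1 := by
      have := Int.lt_floor_add_one a
      simp only [n]; push_cast; linarith
    have hy0 : 0 ≤ y := by apply div_nonneg _ hP.le; linarith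
    have hy1 : y ≤ 1 := by rw [div_le_one hP]; linarith
    have hz0 : (fun j => max 0 (W₁.mulVec x j + b₁ j)) = ![max 0 y, max 0 (y - 1 / 2), 0] := by
      have e : ∑ i, ξ i / 2 ^ K * x i + (θ + n) / 2 ^ K = y := by
        simp only [hy, ht]
        rw [add_assoc, add_div _ (θ + (n : ℝ)), Finset.sum_div]
        congr 1
        apply Finset.sum_congr rfl; intros; ring
      funext j
      fin_cases j
      · simp [W₁, b₁, Matrix.mulVec, dotProduct, ← e]
      · simp [W₁, b₁, Matrix.mulVec, dotProduct, ← e]; rw [add_sub_assoc]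
      · simp [W₁, b₁, Matrix.mulVec, dotProduct]
    simp only [hz0]
    have key : ∀ j ≤ K, ∃ p q, hiddenIter W b j ![max 0 y, max 0 (y - 1 / 2), 0] = ![p, q, 0] ∧
        2 * p - 4 * q = 2 * tri (2 ^ j * y) := by
      intro j
      induction j with
      | zero =>
        intro _
        exact ⟨_, _, rfl, by rw [tri_unit y hy0 hy1]; simp⟩
      | succ j ih =>
        intro hj
        obtain ⟨p, q, h1, h2⟩ := ih (by omega)
        refine ⟨max 0 (2 * tri (2 ^ j * y)), max 0 (2 * tri (2 ^ j * y) - 1 / 2), ?_, ?_⟩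
        · have hjK : j ≠ K := by omega
          rw [hiddenIter, h1, ← h2]
          funext i
          fin_cases i
          · simp [reluLayer, W, b, hjK, Matrix.mulVec, dotProduct, Fin.sum_univ_three]; ring_nf
          · simp [reluLayer, W, b, hjK, Matrix.mulVec, dotProduct, Fin.sum_univ_three]; ring_nf
          · simp [reluLayer, W, b, hjK, Matrix.mulVec, dotProduct]
        · rw [tri_unit, tri_two_tri]
          · ring_nf
          · linarith [tri_nonneg (2 ^ j * y)]
          · linarith [tri_le (2 ^ j * y)]
    obtain ⟨p, q, h1, h2⟩ := key K le_rfl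
    have h3 : (2 : ℝ) ^ K * y = t + n := by simp only [hy]; field_simp
    rw [h3, tri_add_int] at h2
    have h4 : p - 2 * q = tri t := by linarith
    rw [show K + 3 - 2 = K + 1 by omega, hiddenIter, h1, ← h4]
    simp [reluLayer, W, b, Wout, Matrix.mulVec, dotProduct, Fin.sum_univ_three]
    ring_nf

open ProbabilityTheory in
theorem var_point {Z : Type*} [MeasurableSpace Z] (P : Measure Z) [IsProbabilityMeasure P]
    (h : Z → ℝ) (hm : Measurable h) (C : ℝ) (hC : ∀ z, |h z| ≤ C) (m : ℕ) (hm0 : 0 < m) :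
    ∫ ω, (∫ z, h z ∂P - (1 / m) * ∑ i, h (ω i)) ^ 2 ∂(Measure.pi fun _ : Fin m => P) ≤
      (1 / m) * ∫ z, h z ^ 2 ∂P := by
  have hmR : (0 : ℝ) < m := by exact_mod_cast hm0
  have hLp : MemLp h 2 P := MemLp.of_bound hm.aestronglyMeasurable C (Eventually.of_forall hC)
  have hv := variance_sum_pi (ι := Fin m) (μ := fun _ => P) (X := fun _ => h) (fun _ => hLp)
  have hmeas : Measurable (∑ i : Fin m, fun ω : Fin m → Z => h (ω i)) := by
    have : (∑ i : Fin m, fun ω : Fin m → Z => h (ω i)) = fun ω => ∑ i, h (ω i) := by ext; simp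
    rw [this]; fun_prop
  rw [variance_eq_integral hmeas.aemeasurable] at hv
  have hI : ∀ i : Fin m, Integrable (fun ω : Fin m → Z => h (ω i)) (Measure.pi fun _ : Fin m => P) :=
    fun i => Integrable.of_bound (hm.comp (measurable_pi_apply i)).aestronglyMeasurable C (Eventually.of_forall fun ω => hC _)
  have hE : ∫ ω, (∑ i : Fin m, fun ω : Fin m → Z => h (ω i)) ω ∂(Measure.pi fun _ : Fin m => P) =
      m * ∫ z, h z ∂P := by
    simp only [Finset.sum_apply]
    rw [integral_finsetSum _ (fun i _ => hI i)]
    have : ∀ i : Fin m, ∫ ω : Fin m → Z, h (ω i) ∂(Measure.pi fun _ : Fin m => P) = ∫ z, h z ∂P :=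
      fun i => by
        conv_rhs => rw [← (measurePreserving_eval (fun _ : Fin m => P) i).map_eq]
        rw [integral_map (measurable_pi_apply i).aemeasurable hm.aestronglyMeasurable]
    simp [this]
  rw [hE] at hv
  have e : ∀ ω : Fin m → Z, (∫ z, h z ∂P - (1 / m) * ∑ i, h (ω i)) ^ 2 =
      (1 / m : ℝ) ^ 2 * ((∑ i : Fin m, fun ω : Fin m → Z => h (ω i)) ω - m * ∫ z, h z ∂P) ^ 2 := by
    intro ω
    simp only [Finset.sum_apply]
    field_simp
    ring
  simp_rw [e]
  rw [integral_const_mul, hv]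
  have hle := variance_le_expectation_sq (μ := P) hm.aestronglyMeasurable
  simp only [Pi.pow_apply] at hle
  simp only [Finset.sum_const, Finset.card_univ, Fintype.card_fin, nsmul_eq_mul]
  calc (1 / m : ℝ) ^ 2 * (m * variance h P) = (1 / m) * variance h P := by field_simp
    _ ≤ _ := by gcongr

theorem maurey {Z X ι : Type*} [Fintype ι] [MeasurableSpace Z] [MeasurableSpace X]
    (P : Measure Z) [IsProbabilityMeasure P] (ν : Measure X) [IsFiniteMeasure ν]
    (H : ι → Z → X → ℝ) (hm : ∀ k, Measurable (Function.uncurry (H k))) (C : ℝ)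
    (hC : ∀ k z x, |H k z x| ≤ C) (V : ℝ) (hV0 : 0 < V)
    (hV : ∀ x, ∑ k, ∫ z, H k z x ^ 2 ∂P ≤ V)
    (l : Z → ℝ) (hl : Integrable l P) (hl0 : ∀ z, 0 ≤ l z) (hlpos : 0 < ∫ z, l z ∂P)
    (m : ℕ) (hm0 : 0 < m) :
    ∃ ω : Fin m → Z,
      ∑ k, ∫⁻ x, ENNReal.ofReal ((∫ z, H k z x ∂P - (1 / m) * ∑ i, H k (ω i) x) ^ 2) ∂ν ≤
        ENNReal.ofReal (5 * V / m * ν.real Set.univ) ∧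
      ∑ i, l (ω i) ≤ 5 / 4 * m * ∫ z, l z ∂P := by
  have hmR : (0 : ℝ) < m := by exact_mod_cast hm0
  set Q := Measure.pi fun _ : Fin m => P with hQ
  let E : ι → (Fin m → Z) → X → ℝ := fun k ω x =>
    (∫ z, H k z x ∂P - (1 / m) * ∑ i, H k (ω i) x) ^ 2
  have hCn : ∀ k z x, ‖H k z x‖ ≤ C := hC
  have hmk : ∀ k x, Measurable fun z => H k z x := fun k x =>
    (hm k).comp (measurable_id.prodMk measurable_const)
  have hEm : ∀ k, Measurable (Function.uncurry (E k)) := by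
    intro k
    have h1 : Measurable fun x => ∫ z, H k z x ∂P := by
      have := ((hm k).comp measurable_swap).stronglyMeasurable.integral_prod_right' (ν := P)
      exact this.measurable
    have h2 : ∀ i : Fin m, Measurable fun p : (Fin m → Z) × X => H k (p.1 i) p.2 := fun i => by
      have h : Measurable fun p : (Fin m → Z) × X => (p.1 i, p.2) :=
        ((measurable_pi_apply i).comp measurable_fst).prodMk measurable_snd
      exact (hm k).comp h
    have h3 : Measurable fun p : (Fin m → Z) × X =>
        (∫ z, H k z p.2 ∂P - (1 / m) * ∑ i, H k (p.1 i) p.2) ^ 2 :=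
      ((h1.comp measurable_snd).sub
        ((Finset.measurable_sum _ fun i _ => h2 i).const_mul _)).pow_const 2
    exact h3
  have hEb : ∀ k ω x, ‖E k ω x‖ ≤ (2 * C) ^ 2 := by
    intro k ω x
    rw [Real.norm_eq_abs, abs_of_nonneg (sq_nonneg _)]
    have h1 : |∫ z, H k z x ∂P| ≤ C := by
      simpa using norm_integral_le_of_norm_le_const (μ := P) (Eventually.of_forall fun z => hCn k z x)
    have h2 : |(1 / m) * ∑ i, H k (ω i) x| ≤ C := by
      rw [abs_mul, abs_of_pos (by positivity : (0:ℝ) < 1 / m)]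
      have : |∑ i, H k (ω i) x| ≤ m * C := by
        refine (Finset.abs_sum_le_sum_abs _ _).trans ?_
        refine (Finset.sum_le_sum fun i _ => hC k (ω i) x).trans ?_
        simp
      rw [one_div, inv_mul_le_iff₀ hmR]; exact this
    have h3 : |∫ z, H k z x ∂P - (1 / m) * ∑ i, H k (ω i) x| ≤ 2 * C := by
      refine (abs_sub _ _).trans ?_
      linarith
    exact sq_le_sq' (abs_le.1 h3).1 (abs_le.1 h3).2
  have hEint : ∀ k, Integrable (Function.uncurry (E k)) (Q.prod ν) := fun k =>
    Integrable.of_bound (hEm k).aestronglyMeasurable _ (Eventually.of_forall fun p => hEb k p.1 p.2)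
  have hI1 : ∀ k, Integrable (fun ω => ∫ x, E k ω x ∂ν) Q := fun k => (hEint k).integral_prod_left
  have hI2 : ∀ k, Integrable (fun x => ∫ ω, E k ω x ∂Q) ν := fun k => (hEint k).integral_prod_right
  have hA : Integrable (fun ω => ∑ k, ∫ x, E k ω x ∂ν) Q :=
    integrable_finsetSum _ fun k _ => hI1 k
  have hAle : ∫ ω, ∑ k, ∫ x, E k ω x ∂ν ∂Q ≤ V / m * ν.real Set.univ := by
    rw [integral_finsetSum _ fun k _ => hI1 k]
    have : ∀ k, ∫ ω, ∫ x, E k ω x ∂ν ∂Q = ∫ x, ∫ ω, E k ω x ∂Q ∂ν := fun k =>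
      integral_integral_swap (hEint k)
    simp_rw [this]
    rw [← integral_finsetSum _ fun k _ => hI2 k]
    calc ∫ x, ∑ k, ∫ ω, E k ω x ∂Q ∂ν ≤ ∫ x, V / m ∂ν := by
          apply integral_mono
          · exact integrable_finsetSum _ fun k _ => hI2 k
          · exact integrable_const _
          · intro x
            calc ∑ k, ∫ ω, E k ω x ∂Q ≤ ∑ k, (1 / m) * ∫ z, H k z x ^ 2 ∂P :=
                  Finset.sum_le_sum fun k _ => var_point P (fun z => H k z x) (hmk k x) C
                    (fun z => hC k z x) m hm0
              _ = (1 / m) * ∑ k, ∫ z, H k z x ^ 2 ∂P := by rw [Finset.mul_sum]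
              _ ≤ (1 / m) * V := by gcongr; exact hV x
              _ = V / m := by ring
      _ = _ := by simp [mul_comm]
  have hli : ∀ i : Fin m, Integrable (fun ω : Fin m → Z => l (ω i)) Q := fun i => by
    have := (measurePreserving_eval (fun _ : Fin m => P) i)
    exact this.integrable_comp_of_integrable hl
  have hlE : ∫ ω, ∑ i, l (ω i) ∂Q = m * ∫ z, l z ∂P := by
    rw [integral_finsetSum _ (fun i _ => hli i)]
    have : ∀ i : Fin m, ∫ ω : Fin m → Z, l (ω i) ∂Q = ∫ z, l z ∂P :=
      fun i => by
        have h1 := (measurePreserving_eval (fun _ : Fin m => P) i).map_eq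
        have h2 : AEStronglyMeasurable l (Measure.map (Function.eval i) Q) := by rw [h1]; exact hl.1
        conv_rhs => rw [← h1]
        rw [integral_map (measurable_pi_apply i).aemeasurable h2]
    simp [this]
  have hlI : Integrable (fun ω => ∑ i, l (ω i)) Q := integrable_finsetSum _ fun i _ => hli i
  set vol := ν.real Set.univ with hvol
  have hvol0 : 0 ≤ vol := measureReal_nonneg
  set D0 := 5 / 4 * m * ∫ z, l z ∂P with hD0
  have hD0p : 0 < D0 := by positivity
  set A0 := 5 * V / m * vol with hA0
  have hA0n : 0 ≤ A0 := by positivity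
  obtain ⟨ω, hω⟩ := exists_le_integral (μ := Q)
    (f := fun ω => (∑ k, ∫ x, E k ω x ∂ν) / A0 + (∑ i, l (ω i)) / D0)
    ((hA.div_const _).add (hlI.div_const _))
  rw [integral_add (hA.div_const _) (hlI.div_const _), integral_div, integral_div, hlE] at hω
  have h45 : m * ∫ z, l z ∂P = 4 / 5 * D0 := by rw [hD0]; ring
  rw [h45, mul_div_assoc, div_self hD0p.ne'] at hω
  have hAn : 0 ≤ ∑ k, ∫ x, E k ω x ∂ν :=
    Finset.sum_nonneg fun k _ => integral_nonneg fun x => sq_nonneg _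
  have hln : 0 ≤ ∑ i, l (ω i) := Finset.sum_nonneg fun i _ => hl0 _
  have h15 : (∫ ω, ∑ k, ∫ x, E k ω x ∂ν ∂Q) / A0 ≤ 1 / 5 := by
    apply div_le_of_le_mul₀ hA0n (by norm_num)
    refine hAle.trans_eq ?_
    rw [hA0]; ring
  have hsum : (∑ k, ∫ x, E k ω x ∂ν) / A0 + (∑ i, l (ω i)) / D0 ≤ 1 := by linarith
  refine ⟨ω, ?_, ?_⟩
  · have hk : ∀ k, ∫⁻ x, ENNReal.ofReal ((∫ z, H k z x ∂P - (1 / m) * ∑ i, H k (ω i) x) ^ 2) ∂ν =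
        ENNReal.ofReal (∫ x, E k ω x ∂ν) := by
      intro k
      rw [ofReal_integral_eq_lintegral_ofReal]
      · exact Integrable.of_bound
          ((hEm k).comp (measurable_const.prodMk measurable_id)).aestronglyMeasurable _
          (Eventually.of_forall fun x => hEb k ω x)
      · exact Eventually.of_forall fun x => sq_nonneg _
    simp_rw [hk]
    rw [← ENNReal.ofReal_sum_of_nonneg fun k _ => integral_nonneg fun x => sq_nonneg _]
    apply ENNReal.ofReal_le_ofReal
    rcases hA0n.eq_or_lt with h0 | h0
    · have hv0 : vol = 0 := by
        rcases hvol0.eq_or_lt with h | h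
        · exact h.symm
        · have : 0 < A0 := by positivity
          linarith
      have : ν = 0 := by
        have h1 := (measureReal_eq_zero_iff (measure_ne_top ν _)).1 hv0
        exact Measure.measure_univ_eq_zero.1 h1
      rw [this]
      simpa using hA0n
    · have : (∑ k, ∫ x, E k ω x ∂ν) / A0 ≤ 1 := by
        have : 0 ≤ (∑ i, l (ω i)) / D0 := by positivity
        linarith
      rwa [div_le_one h0] at this
  · have : (∑ i, l (ω i)) / D0 ≤ 1 := by
        have : 0 ≤ (∑ k, ∫ x, E k ω x ∂ν) / A0 := by positivity
        linarith
    rwa [div_le_one hD0p] at this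

def hs (s t : ℝ) : ℝ := max 0 (tri t - |s|)

theorem hs_lip (s : ℝ) : LipschitzWith 1 (hs s) := by
  have h : LipschitzWith 1 fun t => tri t - |s| := by
    simpa using tri_lip.sub (LipschitzWith.const |s|)
  exact h.const_max 0

theorem hs_cont : Continuous (Function.uncurry hs) := by
  have := tri_lip.continuous
  unfold hs Function.uncurry
  fun_prop

theorem hs_nonneg (s t : ℝ) : 0 ≤ hs s t := le_max_left _ _

theorem hs_le (s t : ℝ) : hs s t ≤ 1 / 2 :=
  max_le (by norm_num) (by linarith [tri_le t, abs_nonneg s])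

theorem hs_deriv (s t : ℝ) : |deriv (hs s) t| ≤ 1 := by
  simpa using norm_deriv_le_of_lipschitz (hs_lip s) (x₀ := t)

def GG {d : ℕ} (B : ℝ) (θ : (Fin d → ℝ) → ℝ) (z : (Fin d → ℝ) × ℝ) (x : Fin d → ℝ) : ℝ :=
  B / (1 + l1 z.1) * (1 - 2 * π ^ 2 * Real.cos (2 * π * z.2) * hs z.2 (∑ i, z.1 i * x i + θ z.1))

def DG {d : ℕ} (B : ℝ) (θ : (Fin d → ℝ) → ℝ) (j : Fin d) (z : (Fin d → ℝ) × ℝ)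
    (x : Fin d → ℝ) : ℝ :=
  z.1 j * (B / (1 + l1 z.1) * -(2 * π ^ 2 * Real.cos (2 * π * z.2) *
    deriv (hs z.2) (∑ i, z.1 i * x i + θ z.1)))

theorem l1_cont {d : ℕ} : Continuous (l1 : (Fin d → ℝ) → ℝ) := by
  unfold l1; fun_prop

theorem meas_arg {d : ℕ} {θ : (Fin d → ℝ) → ℝ} (hθ : Measurable θ) :
    Measurable fun p : ((Fin d → ℝ) × ℝ) × (Fin d → ℝ) =>
      (p.1.2, ∑ i, p.1.1 i * p.2 i + θ p.1.1) := by
  fun_prop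

theorem GG_meas {d : ℕ} (B : ℝ) {θ : (Fin d → ℝ) → ℝ} (hθ : Measurable θ) :
    Measurable (Function.uncurry (GG B θ)) := by
  have h1 := hs_cont.measurable.comp (meas_arg hθ)
  have h2 : Measurable fun p : ((Fin d → ℝ) × ℝ) × (Fin d → ℝ) => l1 p.1.1 :=
    l1_cont.measurable.comp (by fun_prop)
  have h3 : Measurable fun p : ((Fin d → ℝ) × ℝ) × (Fin d → ℝ) => Real.cos (2 * π * p.1.2) := by
    fun_prop
  exact ((h2.const_add 1).const_div B).mul (((h3.const_mul (2 * π ^ 2)).mul h1).const_sub 1)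

theorem DG_meas {d : ℕ} (B : ℝ) {θ : (Fin d → ℝ) → ℝ} (hθ : Measurable θ) (j : Fin d) :
    Measurable (Function.uncurry (DG B θ j)) := by
  have h1 := (measurable_deriv_with_param hs_cont).comp (meas_arg hθ)
  have h2 : Measurable fun p : ((Fin d → ℝ) × ℝ) × (Fin d → ℝ) => l1 p.1.1 :=
    l1_cont.measurable.comp (by fun_prop)
  have h3 : Measurable fun p : ((Fin d → ℝ) × ℝ) × (Fin d → ℝ) => Real.cos (2 * π * p.1.2) := by
    fun_prop
  have h4 : Measurable fun p : ((Fin d → ℝ) × ℝ) × (Fin d → ℝ) => p.1.1 j := by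
    fun_prop
  exact h4.mul (((h2.const_add 1).const_div B).mul (((h3.const_mul (2 * π ^ 2)).mul h1).neg))

theorem GG_sq {d : ℕ} {B : ℝ} (hB : 0 < B) (θ : (Fin d → ℝ) → ℝ) (z : (Fin d → ℝ) × ℝ)
    (x : Fin d → ℝ) : GG B θ z x ^ 2 ≤ B ^ 2 * (1 + π ^ 2) ^ 2 * (1 / (1 + l1 z.1)) ^ 2 := by
  have hr := l1_nonneg z.1
  have h0 := hs_nonneg z.2 (∑ i, z.1 i * x i + θ z.1)
  have h1 := hs_le z.2 (∑ i, z.1 i * x i + θ z.1)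
  have hc := Real.abs_cos_le_one (2 * π * z.2)
  have h : |1 - 2 * π ^ 2 * Real.cos (2 * π * z.2) * hs z.2 (∑ i, z.1 i * x i + θ z.1)| ≤
      1 + π ^ 2 := by
    refine (abs_sub _ _).trans ?_
    rw [abs_one, abs_mul, abs_mul, abs_of_nonneg h0, abs_of_pos (by positivity : 0 < 2 * π ^ 2)]
    have : 2 * π ^ 2 * |Real.cos (2 * π * z.2)| * hs z.2 (∑ i, z.1 i * x i + θ z.1) ≤
      2 * π ^ 2 * 1 * (1 / 2) := by gcongr
    linarith
  have h2 := sq_le_sq' (abs_le.1 h).1 (abs_le.1 h).2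
  unfold GG
  rw [mul_pow]
  calc _ ≤ (B / (1 + l1 z.1)) ^ 2 * (1 + π ^ 2) ^ 2 := by gcongr
    _ = _ := by ring

theorem DG_sq {d : ℕ} {B : ℝ} (θ : (Fin d → ℝ) → ℝ) (j : Fin d) (z : (Fin d → ℝ) × ℝ)
    (x : Fin d → ℝ) : DG B θ j z x ^ 2 ≤
      (z.1 j) ^ 2 * (B ^ 2 * (4 * π ^ 4) * (1 / (1 + l1 z.1)) ^ 2 * Real.cos (2 * π * z.2) ^ 2) := by
  have hd := hs_deriv z.2 (∑ i, z.1 i * x i + θ z.1)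
  have h2 := sq_le_sq' (abs_le.1 hd).1 (abs_le.1 hd).2
  unfold DG
  calc _ = (z.1 j) ^ 2 * (B ^ 2 * (4 * π ^ 4) * (1 / (1 + l1 z.1)) ^ 2 * Real.cos (2 * π * z.2) ^ 2)
      * (deriv (hs z.2) (∑ i, z.1 i * x i + θ z.1)) ^ 2 := by ring
    _ ≤ (z.1 j) ^ 2 * (B ^ 2 * (4 * π ^ 4) * (1 / (1 + l1 z.1)) ^ 2 * Real.cos (2 * π * z.2) ^ 2)
      * 1 ^ 2 := by gcongr
    _ = _ := by ring

theorem sum_sq_le_l1 {d : ℕ} (ξ : Fin d → ℝ) : ∑ j, ξ j ^ 2 ≤ l1 ξ ^ 2 := by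
  have := Finset.sum_sq_le_sq_sum_of_nonneg (s := Finset.univ) (f := fun j => |ξ j|) (fun _ _ => abs_nonneg _)
  simpa [l1] using this

def HH {d : ℕ} (B : ℝ) (θ : (Fin d → ℝ) → ℝ) : Option (Fin d) → ((Fin d → ℝ) × ℝ) →
    (Fin d → ℝ) → ℝ
  | none => GG B θ
  | some j => DG B θ j

theorem HH_sum {d : ℕ} {B : ℝ} (hB : 0 < B) (θ : (Fin d → ℝ) → ℝ) (z : (Fin d → ℝ) × ℝ)
    (x : Fin d → ℝ) : ∑ k, HH B θ k z x ^ 2 ≤ B ^ 2 * (1 + π ^ 2) ^ 2 * (1 / (1 + l1 z.1)) ^ 2 +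
      B ^ 2 * (4 * π ^ 4) * (l1 z.1 / (1 + l1 z.1)) ^ 2 * Real.cos (2 * π * z.2) ^ 2 := by
  rw [Fintype.sum_option]
  refine add_le_add (GG_sq hB θ z x) ?_
  refine (Finset.sum_le_sum fun j _ => DG_sq θ j z x).trans ?_
  rw [← Finset.sum_mul]
  calc _ ≤ l1 z.1 ^ 2 * (B ^ 2 * (4 * π ^ 4) * (1 / (1 + l1 z.1)) ^ 2 * Real.cos (2 * π * z.2) ^ 2) := by
        gcongr; exact sum_sq_le_l1 _
    _ = _ := by ring

theorem HH_bdd {d : ℕ} {B : ℝ} (hB : 0 < B) (θ : (Fin d → ℝ) → ℝ) (k) (z : (Fin d → ℝ) × ℝ)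
    (x : Fin d → ℝ) : |HH B θ k z x| ≤ B * (1 + 3 * π ^ 2) := by
  have hr := l1_nonneg z.1
  apply abs_le_of_sq_le_sq _ (by positivity)
  have h1 : HH B θ k z x ^ 2 ≤ ∑ k, HH B θ k z x ^ 2 :=
    Finset.single_le_sum (f := fun k => HH B θ k z x ^ 2) (fun _ _ => sq_nonneg _) (Finset.mem_univ k)
  refine (h1.trans (HH_sum hB θ z x)).trans ?_
  have ha : 1 / (1 + l1 z.1) ≤ 1 := by rw [div_le_one (by linarith)]; linarith
  have hb : l1 z.1 / (1 + l1 z.1) ≤ 1 := by rw [div_le_one (by linarith)]; linarith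
  have hc := Real.cos_sq_le_one (2 * π * z.2)
  calc _ ≤ B ^ 2 * (1 + π ^ 2) ^ 2 * 1 ^ 2 + B ^ 2 * (4 * π ^ 4) * 1 ^ 2 * 1 := by gcongr
    _ ≤ _ := by
      have : 0 ≤ B ^ 2 * π ^ 4 := by positivity
      have : 0 ≤ B ^ 2 * π ^ 2 := by positivity
      nlinarith

theorem wp {d : ℕ} (p : ℝ → ℝ) (K : NNReal) (hp : LipschitzWith K p) (ξ : Fin d → ℝ) (θ : ℝ)
    (j : Fin d) (φ : (Fin d → ℝ) → ℝ) (hφ : ContDiff ℝ (⊤ : ℕ∞) φ) (hφc : HasCompactSupport φ) :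
    ∫ x, p (∑ i, ξ i * x i + θ) * fderiv ℝ φ x (Pi.single j 1) =
      - ∫ x, (ξ j * deriv p (∑ i, ξ i * x i + θ)) * φ x := by
  let ℓ : (Fin d → ℝ) →L[ℝ] ℝ := ∑ i, ξ i • ContinuousLinearMap.proj i
  have hℓ : ∀ x, ℓ x = ∑ i, ξ i * x i := fun x => by simp [ℓ]
  have hl2 : LipschitzWith ‖ℓ‖₊ fun x => ℓ x + θ := by
    simpa using ℓ.lipschitz.add (LipschitzWith.const θ)
  have hl : LipschitzWith (K * ‖ℓ‖₊) fun x => p (ℓ x + θ) := hp.comp hl2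
  obtain ⟨D, hD⟩ := hφ.lipschitzWith_of_hasCompactSupport hφc (by simp)
  have := hl.integral_lineDeriv_mul_eq (μ := volume) hD hφc (Pi.single j 1)
  have e1 : ∀ x, lineDeriv ℝ (fun x => p (ℓ x + θ)) x (Pi.single j 1) =
      ξ j * deriv p (∑ i, ξ i * x i + θ) := by
    intro x
    rw [lineDeriv]
    have : (fun t : ℝ => p (ℓ (x + t • Pi.single j 1) + θ)) =
        fun t => (fun u => p ((∑ i, ξ i * x i + θ) + u)) (ξ j * t) := by
      ext t
      have : ℓ (Pi.single j 1) = ξ j := by simp [hℓ, Pi.single_apply]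
      simp only [map_add, map_smul, hℓ x, this, smul_eq_mul]
      ring_nf
    rw [this]
    refine (deriv_comp_mul_left (ξ j) (fun u => p ((∑ i, ξ i * x i + θ) + u)) 0).trans ?_
    rw [deriv_comp_const_add]
    simp
  have e2 : ∀ x, lineDeriv ℝ φ x (-Pi.single j 1) = - fderiv ℝ φ x (Pi.single j 1) := by
    intro x
    rw [((hφ.differentiable (by simp)) x).lineDeriv_eq_fderiv]; simp
  simp_rw [e1, e2, hℓ] at this
  rw [this, ← integral_neg]
  congr 1; ext x; ring

theorem wp_G {d : ℕ} (B : ℝ) (θ : (Fin d → ℝ) → ℝ) (z : (Fin d → ℝ) × ℝ)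
    (j : Fin d) (φ : (Fin d → ℝ) → ℝ) (hφ : ContDiff ℝ (⊤ : ℕ∞) φ) (hφc : HasCompactSupport φ) :
    ∫ x, GG B θ z x * fderiv ℝ φ x (Pi.single j 1) = - ∫ x, DG B θ j z x * φ x := by
  set c := B / (1 + l1 z.1)
  set w := 2 * π ^ 2 * Real.cos (2 * π * z.2)
  have hl : LipschitzWith (‖c * w‖₊) fun t => c * (1 - w * hs z.2 t) := by
    apply LipschitzWith.of_dist_le_mul
    intro s t
    have := (hs_lip z.2).dist_le_mul s t
    rw [Real.dist_eq] at this ⊢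
    have e : c * (1 - w * hs z.2 s) - c * (1 - w * hs z.2 t) = -(c * w) * (hs z.2 s - hs z.2 t) := by ring
    rw [e, abs_mul, abs_neg]
    simp only [coe_nnnorm, Real.norm_eq_abs]
    gcongr
    simpa using this
  have h := wp _ _ hl z.1 (θ z.1) j φ hφ hφc
  have hd : ∀ t, deriv (fun t => c * (1 - w * hs z.2 t)) t = c * -(w * deriv (hs z.2) t) := by
    intro t
    rw [deriv_const_mul_field, deriv_const_sub, deriv_const_mul_field]
  simp_rw [hd] at h
  exact h

def Pxi {d : ℕ} (g : (Fin d → ℝ) → ℂ) : Measure (Fin d → ℝ) :=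
  volume.withDensity fun ξ => ENNReal.ofReal ((1 + l1 ξ) * ‖g ξ‖ / B1 g)

def Ps : Measure ℝ := (2 : ENNReal) • volume.restrict (Set.Ioc (0 : ℝ) (1 / 2))

instance : IsProbabilityMeasure Ps := by
  constructor
  simp only [Ps, Measure.smul_apply, Measure.restrict_apply MeasurableSet.univ, Set.univ_inter,
    Real.volume_Ioc, smul_eq_mul]
  rw [show (2 : ENNReal) = ENNReal.ofReal 2 by simp, ← ENNReal.ofReal_mul (by norm_num)]
  norm_num

theorem int_Ps (h : ℝ → ℝ) : ∫ s, h s ∂Ps = 2 * ∫ s in (0 : ℝ)..(1 / 2), h s := by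
  rw [Ps, integral_smul_measure, intervalIntegral.integral_of_le (by norm_num)]
  simp

theorem dens_meas {d : ℕ} {g : (Fin d → ℝ) → ℂ} (hg : Measurable g) :
    Measurable fun ξ => (1 + l1 ξ) * ‖g ξ‖ / B1 g :=
  ((l1_cont.measurable.const_add 1).mul hg.norm).div_const _

theorem dens_nonneg {d : ℕ} (g : (Fin d → ℝ) → ℂ) (hB : 0 < B1 g) (ξ) :
    0 ≤ (1 + l1 ξ) * ‖g ξ‖ / B1 g := by
  have := l1_nonneg ξ
  positivity

theorem prob_Pxi {d : ℕ} {g : (Fin d → ℝ) → ℂ} (h1 : Integrable fun ξ => (1 + l1 ξ) * ‖g ξ‖)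
    (hB : 0 < B1 g) : IsProbabilityMeasure (Pxi g) := by
  constructor
  rw [Pxi, withDensity_apply _ MeasurableSet.univ, Measure.restrict_univ,
    ← ofReal_integral_eq_lintegral_ofReal (h1.div_const _) (Eventually.of_forall (dens_nonneg g hB)),
    integral_div]
  change ENNReal.ofReal (B1 g / B1 g) = 1
  rw [div_self hB.ne']; simp

theorem int_Pxi {d : ℕ} {g : (Fin d → ℝ) → ℂ} (hg : Measurable g) (hB : 0 < B1 g)
    (h : (Fin d → ℝ) → ℝ) :
    ∫ ξ, h ξ ∂(Pxi g) = ∫ ξ, ((1 + l1 ξ) * ‖g ξ‖ / B1 g) * h ξ := by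
  rw [Pxi, integral_withDensity_eq_integral_toReal_smul (dens_meas hg).ennreal_ofReal
    (Eventually.of_forall fun _ => ENNReal.ofReal_lt_top)]
  congr 1; ext ξ
  rw [ENNReal.toReal_ofReal (dens_nonneg g hB ξ), smul_eq_mul]

theorem integrable_Pxi {d : ℕ} {g : (Fin d → ℝ) → ℂ} (hg : Measurable g) (hB : 0 < B1 g)
    (h : (Fin d → ℝ) → ℝ) (hi : Integrable fun ξ => ((1 + l1 ξ) * ‖g ξ‖ / B1 g) * h ξ) :
    Integrable h (Pxi g) := by
  rw [Pxi, integrable_withDensity_iff_integrable_smul' (dens_meas hg).ennreal_ofReal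
    (Eventually.of_forall fun _ => ENNReal.ofReal_lt_top)]
  refine hi.congr (Eventually.of_forall fun ξ => ?_)
  simp only
  rw [ENNReal.toReal_ofReal (dens_nonneg g hB ξ), smul_eq_mul]

def th {d : ℕ} (g : (Fin d → ℝ) → ℂ) (ξ : Fin d → ℝ) : ℝ := (g ξ).arg / (2 * π)

theorem HH_meas {d : ℕ} (B : ℝ) {θ : (Fin d → ℝ) → ℝ} (hθ : Measurable θ) (k) :
    Measurable (Function.uncurry (HH B θ k)) := by
  cases k with
  | none => exact GG_meas B hθ
  | some j => exact DG_meas B hθ j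

theorem th_meas {d : ℕ} {g : (Fin d → ℝ) → ℂ} (hg : Measurable g) : Measurable (th g) :=
  (Complex.measurable_arg.comp hg).div_const _

theorem inner_int {d : ℕ} (B : ℝ) (θ : (Fin d → ℝ) → ℝ) (ξ x : Fin d → ℝ) :
    ∫ s, GG B θ (ξ, s) x ∂Ps = B / (1 + l1 ξ) * Real.cos (2 * π * (∑ i, ξ i * x i + θ ξ)) := by
  simp only [GG]
  rw [integral_const_mul, int_Ps]
  congr 1
  set t := ∑ i, ξ i * x i + θ ξ
  have hc : Continuous fun s : ℝ => Real.cos (2 * π * s) * max 0 (tri t - s) := by fun_prop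
  have e : ∫ s in (0 : ℝ)..(1 / 2), (1 - 2 * π ^ 2 * Real.cos (2 * π * s) * hs s t) =
      ∫ s in (0 : ℝ)..(1 / 2), (1 - 2 * π ^ 2 * (Real.cos (2 * π * s) * max 0 (tri t - s))) := by
    apply intervalIntegral.integral_congr
    intro s hs'
    rw [Set.uIcc_of_le (by norm_num)] at hs'
    simp only [hs]
    rw [abs_of_nonneg hs'.1]; ring
  rw [e, intervalIntegral.integral_sub (by simp) ((hc.const_mul _).intervalIntegrable _ _),
    intervalIntegral.integral_const_mul, int_relu _ (tri_nonneg t) (tri_le t), cos_tri]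
  have := Real.pi_pos
  simp
  field_simp
  ring

theorem HH_integrable {d : ℕ} {B : ℝ} (hB : 0 < B) {θ : (Fin d → ℝ) → ℝ} (hθ : Measurable θ) (k)
    (P : Measure ((Fin d → ℝ) × ℝ)) [IsFiniteMeasure P] (x : Fin d → ℝ) :
    Integrable (fun z => HH B θ k z x) P :=
  Integrable.of_bound ((HH_meas B hθ k).comp (measurable_id.prodMk measurable_const)).aestronglyMeasurable
    _ (Eventually.of_forall fun z => HH_bdd hB θ k z x)

theorem mean_eq {d : ℕ} {g : (Fin d → ℝ) → ℂ} (hg : Measurable g)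
    (hgi : Integrable g)
    (h1 : Integrable fun ξ => (1 + l1 ξ) * ‖g ξ‖) (hB : 0 < B1 g) (x : Fin d → ℝ) :
    ∫ z, GG (B1 g) (th g) z x ∂((Pxi g).prod Ps) =
      (∫ ξ, g ξ * Complex.exp (2 * π * Complex.I * ((∑ i, ξ i * x i : ℝ) : ℂ))).re := by
  have := prob_Pxi h1 hB
  have hGi : Integrable (fun z => GG (B1 g) (th g) z x) ((Pxi g).prod Ps) :=
    HH_integrable hB (th_meas hg) none _ x
  rw [integral_prod _ hGi]
  simp_rw [inner_int]
  rw [int_Pxi hg hB]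
  have hint : Integrable fun ξ : Fin d → ℝ =>
      g ξ * Complex.exp (2 * π * Complex.I * ((∑ i, ξ i * x i : ℝ) : ℂ)) := by
    refine hgi.mul_bdd (c := 1) ?_ (Eventually.of_forall fun ξ => ?_)
    · apply Continuous.aestronglyMeasurable; fun_prop
    · rw [show (2 * π * Complex.I * ((∑ i, ξ i * x i : ℝ) : ℂ)) =
        ((2 * π * (∑ i, ξ i * x i) : ℝ) : ℂ) * Complex.I by push_cast; ring,
        Complex.norm_exp_ofReal_mul_I]
  have hre := integral_re hint
  simp only [RCLike.re_to_complex] at hre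
  rw [← hre]
  congr 1; ext ξ
  have hr := l1_nonneg ξ
  have hpi := Real.pi_pos
  have e : g ξ * Complex.exp (2 * π * Complex.I * ((∑ i, ξ i * x i : ℝ) : ℂ)) =
      (‖g ξ‖ : ℂ) * Complex.exp (((2 * π * (∑ i, ξ i * x i + th g ξ) : ℝ) : ℂ) * Complex.I) := by
    conv_lhs => rw [← Complex.norm_mul_exp_arg_mul_I (g ξ)]
    rw [mul_assoc, ← Complex.exp_add]
    congr 2
    have : 2 * π * (∑ i, ξ i * x i + th g ξ) = 2 * π * (∑ i, ξ i * x i) + (g ξ).arg := by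
      simp only [th]; field_simp
    rw [this]
    push_cast
    ring
  rw [e, Complex.re_ofReal_mul, Complex.exp_ofReal_mul_I_re]
  have h1r : (1 + l1 ξ) ≠ 0 := by linarith
  have := hB.ne'
  field_simp

theorem moment {d : ℕ} {g : (Fin d → ℝ) → ℂ} (hg : Measurable g)
    (h1 : Integrable fun ξ => (1 + l1 ξ) * ‖g ξ‖) (hB : 0 < B1 g) (x : Fin d → ℝ) :
    ∑ k, ∫ z, HH (B1 g) (th g) k z x ^ 2 ∂((Pxi g).prod Ps) ≤ 11 / 5 * π ^ 4 * B1 g ^ 2 := by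
  have := prob_Pxi h1 hB
  have hI : ∀ k, Integrable (fun z => HH (B1 g) (th g) k z x ^ 2) ((Pxi g).prod Ps) := fun k =>
    Integrable.of_bound (((HH_meas _ (th_meas hg) k).comp
      (measurable_id.prodMk measurable_const)).pow_const 2).aestronglyMeasurable
      ((B1 g * (1 + 3 * π ^ 2)) ^ 2) (Eventually.of_forall fun z => by
        rw [norm_pow]; exact pow_le_pow_left₀ (norm_nonneg _) (HH_bdd hB _ k z x) 2)
  rw [← integral_finsetSum _ fun k _ => hI k]
  set B := B1 g with hBdef
  let α : (Fin d → ℝ) → ℝ := fun ξ => B ^ 2 * (1 + π ^ 2) ^ 2 * (1 / (1 + l1 ξ)) ^ 2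
  let β : (Fin d → ℝ) → ℝ := fun ξ => B ^ 2 * (4 * π ^ 4) * (l1 ξ / (1 + l1 ξ)) ^ 2
  let γ : ℝ → ℝ := fun s => Real.cos (2 * π * s) ^ 2
  have hl := (l1_cont (d := d)).measurable
  have hα : Integrable α (Pxi g) := by
    refine Integrable.of_bound (by fun_prop) (B ^ 2 * (1 + π ^ 2) ^ 2 * 1 ^ 2)
      (Eventually.of_forall fun ξ => ?_)
    have hr := l1_nonneg ξ
    have ha : 1 / (1 + l1 ξ) ≤ 1 := by rw [div_le_one (by linarith)]; linarith
    rw [Real.norm_of_nonneg (by positivity)]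
    simp only [α]; gcongr
  have hβ : Integrable β (Pxi g) := by
    refine Integrable.of_bound (by fun_prop) (B ^ 2 * (4 * π ^ 4) * 1 ^ 2)
      (Eventually.of_forall fun ξ => ?_)
    have hr := l1_nonneg ξ
    have ha : l1 ξ / (1 + l1 ξ) ≤ 1 := by rw [div_le_one (by linarith)]; linarith
    rw [Real.norm_of_nonneg (by positivity)]
    simp only [β]; gcongr
  have hγ : Integrable γ Ps := by
    refine Integrable.of_bound (by fun_prop) 1 (Eventually.of_forall fun s => ?_)
    rw [Real.norm_of_nonneg (by positivity)]
    exact Real.cos_sq_le_one _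
  have hα' : Integrable (fun z : (Fin d → ℝ) × ℝ => α z.1) ((Pxi g).prod Ps) := hα.comp_fst _
  have hβγ : Integrable (fun z : (Fin d → ℝ) × ℝ => β z.1 * γ z.2) ((Pxi g).prod Ps) :=
    hβ.mul_prod hγ
  calc ∫ z, ∑ k, HH B (th g) k z x ^ 2 ∂((Pxi g).prod Ps)
      ≤ ∫ z : (Fin d → ℝ) × ℝ, (α z.1 + β z.1 * γ z.2) ∂((Pxi g).prod Ps) :=
        integral_mono (integrable_finsetSum _ fun k _ => hI k) (hα'.add hβγ)
          fun z => HH_sum hB _ z x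
    _ = ∫ ξ, α ξ ∂(Pxi g) + (∫ ξ, β ξ ∂(Pxi g)) * ∫ s, γ s ∂Ps := by
        rw [integral_add hα' hβγ, integral_prod_mul, integral_fun_fst]
        simp
    _ = ∫ ξ, (α ξ + β ξ * (1 / 2)) ∂(Pxi g) := by
        rw [int_Ps, int_cos_sq, integral_add hα (hβ.mul_const _), integral_mul_const]
        norm_num
    _ ≤ ∫ ξ, 11 / 5 * π ^ 4 * B ^ 2 ∂(Pxi g) := by
        apply integral_mono (hα.add (hβ.mul_const _)) (integrable_const _)
        intro ξ
        have hr := l1_nonneg ξ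
        have hr1 : (0 : ℝ) < 1 + l1 ξ := by linarith
        simp only [α, β, Pi.add_apply]
        have h9 : 9 ≤ π ^ 2 := by nlinarith [Real.pi_gt_three]
        have h2 : (1 + π ^ 2) ^ 2 ≤ 11 / 5 * π ^ 4 := by nlinarith
        have : B ^ 2 * (1 + π ^ 2) ^ 2 * (1 / (1 + l1 ξ)) ^ 2 +
          B ^ 2 * (4 * π ^ 4) * (l1 ξ / (1 + l1 ξ)) ^ 2 * (1 / 2) =
          B ^ 2 * (((1 + π ^ 2) ^ 2 + 2 * π ^ 4 * l1 ξ ^ 2) / (1 + l1 ξ) ^ 2) := by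
            field_simp; ring
        rw [this, mul_comm (11 / 5 * π ^ 4)]
        gcongr
        rw [div_le_iff₀ (by positivity)]
        have h3 : 0 ≤ π ^ 4 * l1 ξ := by positivity
        have h4 : 0 ≤ π ^ 4 * l1 ξ ^ 2 := by positivity
        nlinarith
    _ = _ := by simp

theorem weak_mean {d : ℕ} {B : ℝ} (hB : 0 < B) {θ : (Fin d → ℝ) → ℝ} (hθ : Measurable θ)
    (P : Measure ((Fin d → ℝ) × ℝ)) [IsProbabilityMeasure P]
    (j : Fin d) (φ : (Fin d → ℝ) → ℝ) (hφ : ContDiff ℝ (⊤ : ℕ∞) φ) (hφc : HasCompactSupport φ) :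
    ∫ x, (∫ z, GG B θ z x ∂P) * fderiv ℝ φ x (Pi.single j 1) =
      - ∫ x, (∫ z, DG B θ j z x ∂P) * φ x := by
  have key : ∀ k (ψ : (Fin d → ℝ) → ℝ), Integrable ψ →
      ∫ x, (∫ z, HH B θ k z x ∂P) * ψ x = ∫ z, (∫ x, HH B θ k z x * ψ x) ∂P := by
    intro k ψ hψ
    simp_rw [← integral_mul_const]
    rw [integral_integral_swap]
    have h1 : Integrable (fun p : (Fin d → ℝ) × ((Fin d → ℝ) × ℝ) => ψ p.1) (volume.prod P) :=
      hψ.comp_fst _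
    refine h1.bdd_mul (c := B * (1 + 3 * π ^ 2)) ?_
      (Eventually.of_forall fun p => HH_bdd hB θ k p.2 p.1)
    exact ((HH_meas B hθ k).comp measurable_swap).aestronglyMeasurable
  have hφi : Integrable φ := hφ.continuous.integrable_of_hasCompactSupport hφc
  have hdi : Integrable fun x => fderiv ℝ φ x (Pi.single j 1) := by
    apply Continuous.integrable_of_hasCompactSupport
    · exact (hφ.continuous_fderiv (by simp)).clm_apply continuous_const
    · exact hφc.fderiv_apply ℝ _
  have h1 := key none _ hdi
  have h2 := key (some j) _ hφi
  simp only [HH] at h1 h2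
  rw [h1, h2, ← integral_neg]
  congr 1; ext z
  exact wp_G B θ z j φ hφ hφc

theorem weak_all {d : ℕ} {B : ℝ} (hB : 0 < B) {θ : (Fin d → ℝ) → ℝ} (hθ : Measurable θ)
    (P : Measure ((Fin d → ℝ) × ℝ)) [IsProbabilityMeasure P] (m : ℕ)
    (ω : Fin m → ((Fin d → ℝ) × ℝ)) (Ω : Set (Fin d → ℝ)) (j : Fin d) :
    HasWeakPartial Ω (fun x => ∫ z, GG B θ z x ∂P - (1 / m) * ∑ i, GG B θ (ω i) x) j
      (fun x => ∫ z, DG B θ j z x ∂P - (1 / m) * ∑ i, DG B θ j (ω i) x) := by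
  intro φ hφ hφc hsupp
  have hφi : Integrable φ := hφ.continuous.integrable_of_hasCompactSupport hφc
  have hdi : Integrable fun x => fderiv ℝ φ x (Pi.single j 1) := by
    apply Continuous.integrable_of_hasCompactSupport
    · exact (hφ.continuous_fderiv (by simp)).clm_apply continuous_const
    · exact hφc.fderiv_apply ℝ _
  have hout : ∀ x ∉ Ω, x ∉ tsupport φ := fun x hx h => hx (interior_subset (hsupp h))
  have hz1 : ∀ x ∉ Ω, φ x = 0 := fun x hx => image_eq_zero_of_notMem_tsupport (hout x hx)
  have hz2 : ∀ x ∉ Ω, fderiv ℝ φ x (Pi.single j 1) = 0 := fun x hx => by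
    have : x ∉ tsupport (fderiv ℝ φ) := fun h => hout x hx (tsupport_fderiv_subset ℝ h)
    rw [image_eq_zero_of_notMem_tsupport this]; simp
  rw [setIntegral_eq_integral_of_forall_compl_eq_zero (fun x hx => by rw [hz2 x hx, mul_zero]),
    setIntegral_eq_integral_of_forall_compl_eq_zero (fun x hx => by rw [hz1 x hx, mul_zero])]
  have lin : ∀ k (ψ : (Fin d → ℝ) → ℝ), Integrable ψ →
      ∫ x, (∫ z, HH B θ k z x ∂P - (1 / m) * ∑ i, HH B θ k (ω i) x) * ψ x =
      (∫ x, (∫ z, HH B θ k z x ∂P) * ψ x) - (1 / m) * ∑ i, ∫ x, HH B θ k (ω i) x * ψ x := by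
    intro k ψ hψ
    have i1 : ∀ z, Integrable fun x => HH B θ k z x * ψ x := fun z =>
      hψ.bdd_mul (c := B * (1 + 3 * π ^ 2))
        ((HH_meas B hθ k).comp (measurable_const.prodMk measurable_id)).aestronglyMeasurable
        (Eventually.of_forall fun x => HH_bdd hB θ k z x)
    have i2 : Integrable fun x => (∫ z, HH B θ k z x ∂P) * ψ x := by
      refine hψ.bdd_mul (c := B * (1 + 3 * π ^ 2)) ?_ (Eventually.of_forall fun x => ?_)
      · exact (((HH_meas B hθ k).comp measurable_swap).stronglyMeasurable.integral_prod_right'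
          (ν := P)).aestronglyMeasurable
      · have hb : ∀ z, ‖HH B θ k z x‖ ≤ B * (1 + 3 * π ^ 2) := fun z => HH_bdd hB θ k z x
        simpa using norm_integral_le_of_norm_le_const (μ := P) (Eventually.of_forall hb)
    have i3 : Integrable fun x => (1 / m : ℝ) * ∑ i, HH B θ k (ω i) x * ψ x :=
      (integrable_finsetSum _ fun i _ => i1 (ω i)).const_mul _
    rw [← integral_finsetSum _ fun i _ => i1 (ω i), ← integral_const_mul, ← integral_sub i2 i3]
    congr 1; ext x
    rw [sub_mul, mul_assoc, Finset.sum_mul]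
  have h1 := lin none _ hdi
  have h2 := lin (some j) _ hφi
  simp only [HH] at h1 h2
  rw [h1, h2, weak_mean hB hθ P j φ hφ hφc]
  simp_rw [fun i => wp_G B θ (ω i) j φ hφ hφc]
  simp only [Finset.sum_neg_distrib]
  ring

theorem logb_ge_one {d : ℕ} (ξ : Fin d → ℝ) : 1 ≤ Real.logb 2 (2 + l1 ξ) := by
  have := l1_nonneg ξ
  rw [Real.le_logb_iff_rpow_le one_lt_two (by linarith)]
  simp; linarith

theorem integrable_of_B1 {d : ℕ} (f : (Fin d → ℝ) → ℝ) (hB1 : 0 < B1 (fhatR f)) :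
    Integrable f := by
  by_contra hf
  have h0 : ∀ ξ, fhatR f ξ = 0 := by
    intro ξ
    rw [fhatR, fhat]
    apply integral_undef
    intro hi
    apply hf
    have hn := hi.bdd_mul (c := 1)
      (f := fun x : Fin d → ℝ => Complex.exp (2 * (π : ℂ) * Complex.I * ((∑ i, ξ i * x i : ℝ) : ℂ)))
      (Continuous.aestronglyMeasurable (by fun_prop)) (Eventually.of_forall fun x => by
        rw [show (2 * (π : ℂ) * Complex.I * ((∑ i, ξ i * x i : ℝ) : ℂ)) =
          ((2 * π * (∑ i, ξ i * x i) : ℝ) : ℂ) * Complex.I by push_cast; ring,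
          Complex.norm_exp_ofReal_mul_I])
    have := hn.re
    refine this.congr (Eventually.of_forall fun x => ?_)
    simp only
    rw [← mul_assoc, ← Complex.exp_add]
    simp
  have : B1 (fhatR f) = 0 := by simp [B1, h0]
  linarith


/-- If `f : ℝ^d → ℝ` has `f̂ ∈ L¹`, `‖f‖_{B^{1,log}} < ∞` and
`‖f‖_{B¹} > 0`, then for every `m ≥ 1` and compact `Ω ⊆ [0,1]^d` there are ReLU networks
`F₁,…,F_m` of width `3`, depths `L₁,…,L_m`, such that `f - (1/m)∑ F_i` has weak partial
derivatives `v_j` on `Ω` with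
`‖f - (1/m)∑ F_i‖²_{H¹(Ω)} ≤ (11π⁴/m)|Ω|‖f‖²_{B¹}` and
`∑ L_i ≤ 5m ‖f‖_{B^{1,log}}/‖f‖_{B¹}`. -/
theorem H1_approx_unit_cube (d : ℕ) (f : (Fin d → ℝ) → ℝ)
    (hf1 : Integrable (fhatR f))
    (hf1log : Integrable (fun ξ => (1 + l1 ξ) * Real.logb 2 (2 + l1 ξ) * ‖fhatR f ξ‖))
    (hB1 : 0 < B1 (fhatR f))
    (m : ℕ) (hm : 0 < m)
    (Ω : Set (Fin d → ℝ)) (hΩc : IsCompact Ω) (hΩ : Ω ⊆ Set.Icc 0 1) :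
    ∃ (L : Fin m → ℕ) (F : Fin m → (Fin d → ℝ) → ℝ) (v : Fin d → (Fin d → ℝ) → ℝ),
      (∀ i, IsReLUNet d 3 (L i) (F i)) ∧
      (∀ j, HasWeakPartial Ω (fun x => f x - (1 / m) * ∑ i, F i x) j (v j)) ∧
      ((∫⁻ x in Ω, ENNReal.ofReal ((f x - (1 / m) * ∑ i, F i x) ^ 2)) +
        ∑ j : Fin d, ∫⁻ x in Ω, ENNReal.ofReal (v j x ^ 2)) ≤
        ENNReal.ofReal (11 * Real.pi ^ 4 / m * (volume Ω).toReal * B1 (fhatR f) ^ 2) ∧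
      (∑ i, (L i : ℝ)) ≤ 5 * m * B1log (fhatR f) / B1 (fhatR f) := by
  have hfi := integrable_of_B1 f hB1
  have hinv := fhat_inv f hfi hf1
  obtain ⟨g, hgm, hge⟩ : ∃ g, Measurable g ∧ fhatR f =ᵐ[volume] g :=
    ⟨hf1.1.mk _, hf1.1.stronglyMeasurable_mk.measurable, hf1.1.ae_eq_mk⟩
  have eB1 : B1 (fhatR f) = B1 g := by
    apply integral_congr_ae
    filter_upwards [hge] with ξ h; rw [h]
  have eB1l : B1log (fhatR f) = B1log g := by
    apply integral_congr_ae
    filter_upwards [hge] with ξ h; rw [h]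
  have hgi : Integrable g := hf1.congr hge
  have hglog : Integrable (fun ξ => (1 + l1 ξ) * Real.logb 2 (2 + l1 ξ) * ‖g ξ‖) := by
    refine hf1log.congr ?_
    filter_upwards [hge] with ξ h; rw [h]
  have hg1 : Integrable (fun ξ => (1 + l1 ξ) * ‖g ξ‖) := by
    refine hglog.mono' ((l1_cont.measurable.const_add 1).mul hgm.norm).aestronglyMeasurable
      (Eventually.of_forall fun ξ => ?_)
    have hr := l1_nonneg ξ
    have hl := logb_ge_one ξ
    rw [Real.norm_of_nonneg (by positivity)]
    gcongr
    nlinarith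
  rw [eB1] at hB1 ⊢
  rw [eB1l]
  have hprob := prob_Pxi hg1 hB1
  have hθ := th_meas hgm
  set B := B1 g with hBdef
  set P := (Pxi g).prod Ps with hP
  have hinvg : ∀ᵐ x, f x = ∫ z, GG B (th g) z x ∂P := by
    filter_upwards [hinv] with x hx
    rw [hx, mean_eq hgm hgi hg1 hB1 x]
    congr 1
    apply integral_congr_ae
    filter_upwards [hge] with ξ h; rw [h]
  have hΩfin : volume Ω < ⊤ := hΩc.measure_lt_top
  have : IsFiniteMeasure (volume.restrict Ω) := ⟨by simpa using hΩfin⟩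
  have hlI : Integrable (fun ξ => 4 * Real.logb 2 (2 + l1 ξ)) (Pxi g) := by
    apply integrable_Pxi hgm hB1
    refine (hglog.const_mul (4 / B)).congr (Eventually.of_forall fun ξ => ?_)
    simp only [← hBdef]; ring
  have hlE : ∫ ξ, 4 * Real.logb 2 (2 + l1 ξ) ∂(Pxi g) = 4 * B1log g / B := by
    rw [int_Pxi hgm hB1, B1log, ← integral_const_mul, ← integral_div]
    congr 1; ext ξ
    simp only [← hBdef]; ring
  have hlE' : ∫ z : (Fin d → ℝ) × ℝ, 4 * Real.logb 2 (2 + l1 z.1) ∂P = 4 * B1log g / B := by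
    rw [hP, integral_fun_fst (fun ξ : Fin d → ℝ => 4 * Real.logb 2 (2 + l1 ξ)), hlE]; simp
  have hlI' : Integrable (fun z : (Fin d → ℝ) × ℝ => 4 * Real.logb 2 (2 + l1 z.1)) P :=
    hlI.comp_fst _
  obtain ⟨ω, hω1, hω2⟩ := maurey P (volume.restrict Ω) (HH B (th g)) (HH_meas B hθ)
    (B * (1 + 3 * π ^ 2)) (HH_bdd hB1 (th g)) (11 / 5 * π ^ 4 * B ^ 2) (by positivity)
    (moment hgm hg1 hB1) (fun z => 4 * Real.logb 2 (2 + l1 z.1)) hlI'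
    (fun z => by have := logb_ge_one z.1; positivity)
    (by
      have h1 : ∫ z : (Fin d → ℝ) × ℝ, (4 : ℝ) ∂P ≤ ∫ z : (Fin d → ℝ) × ℝ, 4 * Real.logb 2 (2 + l1 z.1) ∂P :=
        integral_mono (integrable_const _) hlI' fun z => by
          have := logb_ge_one z.1
          simp only; linarith
      simp only [integral_const, probReal_univ, smul_eq_mul, one_mul] at h1
      linarith) m hm
  rw [hlE'] at hω2
  choose L F hnet hL hF using fun i => net_exists (ω i).1 (th g (ω i).1) |(ω i).2|
    (B / (1 + l1 (ω i).1)) (2 * π ^ 2 * Real.cos (2 * π * (ω i).2))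
  have hFG : ∀ i, ∀ x ∈ Ω, F i x = GG B (th g) (ω i) x := fun i x hx => hF i x (hΩ hx)
  have hae : ∀ᵐ x ∂(volume.restrict Ω), f x - (1 / m) * ∑ i, F i x =
      ∫ z, GG B (th g) z x ∂P - (1 / m) * ∑ i, GG B (th g) (ω i) x := by
    filter_upwards [ae_restrict_of_ae hinvg, ae_restrict_mem hΩc.measurableSet] with x h1 h2
    rw [h1]
    congr 2
    exact Finset.sum_congr rfl fun i _ => hFG i x h2
  refine ⟨L, F, fun j x => ∫ z, DG B (th g) j z x ∂P - (1 / m) * ∑ i, DG B (th g) j (ω i) x,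
    hnet, ?_, ?_, ?_⟩
  · intro j φ hφ hφc hsupp
    rw [← weak_all hB1 hθ P m ω Ω j φ hφ hφc hsupp]
    apply integral_congr_ae
    filter_upwards [hae] with x hx
    rw [hx]
  · have e : ∫⁻ x in Ω, ENNReal.ofReal ((f x - (1 / m) * ∑ i, F i x) ^ 2) =
        ∫⁻ x in Ω, ENNReal.ofReal
          ((∫ z, GG B (th g) z x ∂P - (1 / m) * ∑ i, GG B (th g) (ω i) x) ^ 2) := by
      apply lintegral_congr_ae
      filter_upwards [hae] with x hx
      rw [hx]
    rw [e]
    rw [Fintype.sum_option] at hω1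
    refine hω1.trans (ENNReal.ofReal_le_ofReal (le_of_eq ?_))
    rw [measureReal_restrict_apply_univ, Measure.real]
    ring
  · refine (Finset.sum_le_sum fun i _ => hL i).trans (hω2.trans (le_of_eq ?_))
    ring

end
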